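/- Let k be an algebraically closed field and A a spectroid over k. If 0 → L → M → N → 0 is an almost split sequence in mod A, then L is finitely co-presented and N is finitely presented. -/

import Mathlib

open CategoryTheory CategoryTheory.Limits

namespace Paper

variable (k : Type) [Field k]

section General

variable (A : Type) [Category.{0} A] [Preadditive A] [CategoryTheory.Linear k A]

/-- A spectroid over `k`: a (small) Hom-finite `k`-linear category in which every object
has a local endomorphism ring and distinct objects are not isomorphic. -/
class Spectroid : Prop where
  homFinite : ∀ a b : A, FiniteDimensional k (a ⟶ b)
  localEnd : ∀ a : A, IsLocalRing (End a)
  skeletal : ∀ a b : A, (a ≅ b) → a = b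

variable {A}

/-- `M` is a module over `A`, i.e. the functor `M : A ⥤ ModuleCat k` is additive and
`k`-linear on morphisms. -/
def IsMod (M : A ⥤ ModuleCat.{0} k) : Prop :=
  (∀ {a b : A} (f g : a ⟶ b), M.map (f + g) = M.map f + M.map g) ∧
  (∀ {a b : A} (r : k) (f : a ⟶ b), M.map (r • f) = r • M.map f)

/-- `M` is a locally finite dimensional module over `A`, i.e. an object of `mod A`. -/
def IsLfdMod (M : A ⥤ ModuleCat.{0} k) : Prop :=
  IsMod k M ∧ ∀ a : A, FiniteDimensional k (M.obj a)

/-- The projective module `P_a = Hom_A(a, -)` at an object `a`. -/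
noncomputable def ProjAt (a : A) : A ⥤ ModuleCat.{0} k :=
  (linearCoyoneda k A).obj (Opposite.op a)

/-- The injective module `I_a = D Hom_A(-, a)` at an object `a`. -/
noncomputable def InjAt (a : A) : A ⥤ ModuleCat.{0} k where
  obj b := ModuleCat.of k (Module.Dual k (b ⟶ a))
  map {b c} f := ModuleCat.ofHom (LinearMap.dualMap (Linear.leftComp k a f))
  map_id b := by
    have h : Linear.leftComp k a (𝟙 b) = LinearMap.id := by
      apply LinearMap.ext; intro g; simp
    rw [h, LinearMap.dualMap_id]; rfl
  map_comp {b c d} f g := by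
    have h : Linear.leftComp k a (f ≫ g) =
        (Linear.leftComp k a f).comp (Linear.leftComp k a g) := by
      apply LinearMap.ext; intro h; simp
    rw [h]; rfl

instance : HasFiniteBiproducts (A ⥤ ModuleCat.{0} k) :=
  CategoryTheory.Abelian.hasFiniteBiproducts

/-- `M` is finitely generated: there is an epimorphism `⊕_{i=1}^r P_{a_i} → M`. -/
def IsFG (M : A ⥤ ModuleCat.{0} k) : Prop :=
  ∃ (r : ℕ) (a : Fin r → A) (f : (⨁ fun i => ProjAt k (a i)) ⟶ M), Epi f

/-- `M` is finitely presented: there is an epimorphism `⊕_{i=1}^r P_{a_i} → M` with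
finitely generated kernel. -/
def IsFP (M : A ⥤ ModuleCat.{0} k) : Prop :=
  ∃ (r : ℕ) (a : Fin r → A) (f : (⨁ fun i => ProjAt k (a i)) ⟶ M),
    Epi f ∧ IsFG k (kernel f)

/-- `M` is finitely co-generated: there is a monomorphism `M → ⊕_{j=1}^s I_{b_j}`. -/
def IsFCG (M : A ⥤ ModuleCat.{0} k) : Prop :=
  ∃ (s : ℕ) (b : Fin s → A) (f : M ⟶ ⨁ fun j => InjAt k (b j)), Mono f

/-- `M` is finitely co-presented: there is a monomorphism `M → ⊕_{j=1}^s I_{b_j}` with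
finitely co-generated cokernel. -/
def IsFCP (M : A ⥤ ModuleCat.{0} k) : Prop :=
  ∃ (s : ℕ) (b : Fin s → A) (f : M ⟶ ⨁ fun j => InjAt k (b j)),
    Mono f ∧ IsFCG k (cokernel f)

/-- `f` is an irreducible morphism in `mod A`: it is neither a split mono nor a split epi,
and in any factorization `f = g ≫ h` through an object of `mod A`, `g` is a split mono
or `h` is a split epi. -/
def Irred {L M : A ⥤ ModuleCat.{0} k} (f : L ⟶ M) : Prop :=
  ¬ IsSplitMono f ∧ ¬ IsSplitEpi f ∧
    ∀ ⦃X : A ⥤ ModuleCat.{0} k⦄, IsLfdMod k X →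
      ∀ (g : L ⟶ X) (h : X ⟶ M), g ≫ h = f → IsSplitMono g ∨ IsSplitEpi h

/-- `M` is an indecomposable object of `mod A`: it is nonzero, and whenever `M ≅ X ⊞ Y`
with `X`, `Y` in `mod A`, one of `X`, `Y` is zero. -/
def Indec (M : A ⥤ ModuleCat.{0} k) : Prop :=
  ¬ IsZero M ∧ ∀ ⦃X Y : A ⥤ ModuleCat.{0} k⦄, IsLfdMod k X → IsLfdMod k Y →
    (M ≅ X ⊞ Y) → IsZero X ∨ IsZero Y

/-- `0 → L →f M →g N → 0` is an almost split sequence in `mod A`. -/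
structure AlmostSplitSeq {L M N : A ⥤ ModuleCat.{0} k} (f : L ⟶ M) (g : M ⟶ N) : Prop where
  mono : Mono f
  epi : Epi g
  zero : f ≫ g = 0
  exact : (ShortComplex.mk f g zero).Exact
  not_splitMono : ¬ IsSplitMono f
  not_splitEpi : ¬ IsSplitEpi g
  left_almost_split : ∀ ⦃X : A ⥤ ModuleCat.{0} k⦄, IsLfdMod k X →
    ∀ u : L ⟶ X, ¬ IsSplitMono u → ∃ v : M ⟶ X, f ≫ v = u
  right_almost_split : ∀ ⦃X : A ⥤ ModuleCat.{0} k⦄, IsLfdMod k X →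
    ∀ u : X ⟶ N, ¬ IsSplitEpi u → ∃ v : X ⟶ M, v ≫ g = u

/-- `M` is projective as an object of `mod A`. -/
def ProjInMod (M : A ⥤ ModuleCat.{0} k) : Prop :=
  ∀ ⦃X Y : A ⥤ ModuleCat.{0} k⦄, IsLfdMod k X → IsLfdMod k Y →
    ∀ (e : X ⟶ Y), Epi e → ∀ u : M ⟶ Y, ∃ t : M ⟶ X, t ≫ e = u

/-- `M` is injective as an object of `mod A`. -/
def InjInMod (M : A ⥤ ModuleCat.{0} k) : Prop :=
  ∀ ⦃X Y : A ⥤ ModuleCat.{0} k⦄, IsLfdMod k X → IsLfdMod k Y →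
    ∀ (m : X ⟶ Y), Mono m → ∀ u : X ⟶ M, ∃ t : Y ⟶ M, m ≫ t = u

/-- `h` is a (nonempty) composition of irreducible morphisms between indecomposable
objects of `mod A`. -/
inductive IrredChain : ∀ {X Y : A ⥤ ModuleCat.{0} k}, (X ⟶ Y) → Prop
  | single {X Y : A ⥤ ModuleCat.{0} k} (f : X ⟶ Y) :
      IsLfdMod k X → Indec k X → IsLfdMod k Y → Indec k Y → Irred k f → IrredChain f
  | comp {X Y Z : A ⥤ ModuleCat.{0} k} (f : X ⟶ Y) (g : Y ⟶ Z) :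
      IsLfdMod k X → Indec k X → Irred k f → IrredChain g → IrredChain (f ≫ g)

end General

section QuiverSection

variable (Q : Type) [Quiver.{0} Q]

/-- `Q` is locally finite: every vertex is the source of finitely many arrows and the
target of finitely many arrows. -/
def LocallyFinite : Prop :=
  ∀ x : Q, Finite (Σ y : Q, x ⟶ y) ∧ Finite (Σ y : Q, y ⟶ x)

/-- `Q` is interval finite: there are finitely many paths between any two vertices. -/
def IntervalFinite : Prop :=
  ∀ x y : Q, Finite (Quiver.Path x y)

/-- `Q` is strongly locally finite: locally finite and interval finite. -/
def StronglyLocallyFinite : Prop :=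
  LocallyFinite Q ∧ IntervalFinite Q

/-- `Q` is connected: nonempty, and any two vertices are joined by a walk. -/
def QuiverConnected : Prop :=
  Nonempty Q ∧ ∀ x y : Q,
    Nonempty (Quiver.Path (Quiver.Symmetrify.of.obj x) (Quiver.Symmetrify.of.obj y))

/-- The path category `kQ` of the quiver `Q`: the free `k`-linear category on the free
category on `Q`. -/
abbrev PathCat := CategoryTheory.Free k (Paths Q)

/-- A vertex of `Q`, seen as an object of the path category `kQ`. -/
noncomputable def vtx (x : Q) : PathCat k Q :=
  (Free.embedding k (Paths Q)).obj ((Paths.of Q).obj x)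

/-- An arrow of `Q`, seen as a morphism of the path category `kQ`. -/
noncomputable def arrHom {x y : Q} (α : x ⟶ y) : vtx k Q x ⟶ vtx k Q y :=
  (Free.embedding k (Paths Q)).map ((Paths.of Q).map α)

/-- The degree of a vertex of `Q`: the total number of arrows incident to it. -/
noncomputable def degree (x : Q) : ℕ :=
  Nat.card ((Σ y : Q, x ⟶ y) ⊕ (Σ y : Q, y ⟶ x))

/-- `M` belongs to `rrep(Q)`: it is the middle term of a short exact sequence
`0 → L → M → N → 0` with `L` finitely presented, `N` finitely co-presented, and only
finitely many arrows `α` of `Q` satisfy `M(α) ≠ 0`, `L(α) = 0` and `N(α) = 0`. -/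
def InRrep (M : PathCat k Q ⥤ ModuleCat.{0} k) : Prop :=
  ∃ (L N : PathCat k Q ⥤ ModuleCat.{0} k) (f : L ⟶ M) (g : M ⟶ N) (zero : f ≫ g = 0),
    Mono f ∧ Epi g ∧ (ShortComplex.mk f g zero).Exact ∧ IsFP k L ∧ IsFCP k N ∧
    Set.Finite {p : Σ (x : Q) (y : Q), x ⟶ y |
      M.map (arrHom k Q p.2.2) ≠ 0 ∧ L.map (arrHom k Q p.2.2) = 0 ∧
      N.map (arrHom k Q p.2.2) = 0}

variable {Q}

/-- The vertices occurring in a path. -/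
def InPath {x : Q} : ∀ {y : Q}, Quiver.Path x y → Q → Prop
  | _, Quiver.Path.nil, v => v = x
  | _, @Quiver.Path.cons _ _ _ _ c p _, v => v = c ∨ InPath p v

variable (Q)

/-- `Q` is a star quiver: it is obtained from a finite full convex subquiver `Γ` by
attaching finitely many rays and co-rays with no common vertices. -/
def IsStarQuiver : Prop :=
  ∃ (Γ S₁ S₂ : Set Q) (v : Q → ℕ → Q),
    Γ.Finite ∧ S₁ ⊆ Γ ∧ S₂ ⊆ Γ ∧ Disjoint S₁ S₂ ∧
    (∀ x y : Q, x ∈ Γ → y ∈ Γ → ∀ p : Quiver.Path x y, ∀ z : Q, InPath p z → z ∈ Γ) ∧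
    (∀ s ∈ S₁ ∪ S₂, ∀ i : ℕ, v s i ∉ Γ) ∧
    (∀ s ∈ S₁ ∪ S₂, ∀ t ∈ S₁ ∪ S₂, ∀ i j : ℕ, v s i = v t j → s = t ∧ i = j) ∧
    (∀ x : Q, x ∉ Γ → ∃ s ∈ S₁ ∪ S₂, ∃ i : ℕ, x = v s i) ∧
    (∀ s ∈ S₁, Nat.card (s ⟶ v s 0) = 1 ∧ ∀ i : ℕ, Nat.card (v s i ⟶ v s (i + 1)) = 1) ∧
    (∀ s ∈ S₂, Nat.card (v s 0 ⟶ s) = 1 ∧ ∀ i : ℕ, Nat.card (v s (i + 1) ⟶ v s i) = 1) ∧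
    (∀ x y : Q, (x ⟶ y) → ¬(x ∈ Γ ∧ y ∈ Γ) →
      (∃ s ∈ S₁, (x = s ∧ y = v s 0) ∨ ∃ i : ℕ, x = v s i ∧ y = v s (i + 1)) ∨
      (∃ s ∈ S₂, (x = v s 0 ∧ y = s) ∨ ∃ i : ℕ, x = v s (i + 1) ∧ y = v s i))

end QuiverSection

section AlmostSplit

theorem exists_dual_of_directed {ι V : Type*} [Preorder ι] [IsDirectedOrder ι] [Nonempty ι]
    [AddCommGroup V] [Module k V] (E : ι → Set (V × k)) (hE : Monotone E)
    (h : ∀ i, ∃ φ : Module.Dual k V, ∀ e ∈ E i, φ e.1 = e.2) :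
    ∃ φ : Module.Dual k V, ∀ i, ∀ e ∈ E i, φ e.1 = e.2 := by
  have key : ((0 : V), (1 : k)) ∉ ⨆ i, Submodule.span k (E i) := by
    rw [Submodule.mem_iSup_of_directed _
      (Monotone.directed_le fun i j hij => Submodule.span_mono (hE hij))]
    rintro ⟨i, hi⟩
    obtain ⟨φ, hφ⟩ := h i
    have hle : Submodule.span k (E i) ≤
        LinearMap.ker (LinearMap.snd k V k - φ ∘ₗ LinearMap.fst k V k) := by
      rw [Submodule.span_le]
      intro e he
      simp [hφ e he]
    simpa using hle hi
  obtain ⟨ψ, hψ, hle⟩ := Submodule.exists_le_ker_of_notMem key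
  refine ⟨-(ψ (0, 1))⁻¹ • (ψ ∘ₗ LinearMap.inl k V k), fun i e he => ?_⟩
  have h0 : ψ e = 0 := hle (Submodule.mem_iSup_of_mem i (Submodule.subset_span he))
  have h1 : e = (e.1, 0) + e.2 • ((0 : V), (1 : k)) := by ext <;> simp
  rw [h1, map_add, map_smul, smul_eq_mul] at h0
  have h2 : ψ (e.1, 0) = - (e.2 * ψ (0, 1)) := eq_neg_of_add_eq_zero_left h0
  simp only [LinearMap.smul_apply, LinearMap.comp_apply, LinearMap.inl_apply, smul_eq_mul, h2]
  field_simp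

variable {A : Type} [Category.{0} A]

/-- A compactness principle for natural transformations into a functor with finite dimensional
values: a natural transformation subject to linear conditions at single objects exists as soon
as it exists on every finite full subcategory. -/
theorem exists_natTrans_of_finite {F G : A ⥤ ModuleCat.{0} k}
    (hG : ∀ a, FiniteDimensional k (G.obj a))
    (C : ∀ a, F.obj a → Module.Dual k (G.obj a) → k → Prop)
    (h : ∀ S : Finset A, ∃ s : ∀ a, F.obj a ⟶ G.obj a,
      (∀ a ∈ S, ∀ b ∈ S, ∀ α : a ⟶ b, F.map α ≫ s b = s a ≫ G.map α) ∧
      ∀ a ∈ S, ∀ x η c, C a x η c → η ((s a).hom x) = c) :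
    ∃ t : F ⟶ G, ∀ a x η c, C a x η c → η ((t.app a).hom x) = c := by
  classical
  let W : A → Type := fun a => TensorProduct k (F.obj a) (Module.Dual k (G.obj a))
  let V := DirectSum A W
  let δ : ∀ a, F.obj a → Module.Dual k (G.obj a) → V :=
    fun a x η => DirectSum.lof k A W a (TensorProduct.tmul k x η)
  let E : Finset A → Set (V × k) := fun S =>
    {e | (∃ a ∈ S, ∃ b ∈ S, ∃ (α : a ⟶ b) (x : F.obj a) (η : Module.Dual k (G.obj b)),
        e = (δ b ((F.map α).hom x) η - δ a x (η ∘ₗ (G.map α).hom), 0)) ∨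
      ∃ a ∈ S, ∃ x η c, C a x η c ∧ e = (δ a x η, c)}
  have hE : Monotone E := by
    rintro S T hST e (⟨a, ha, b, hb, h⟩ | ⟨a, ha, h⟩)
    · exact Or.inl ⟨a, hST ha, b, hST hb, h⟩
    · exact Or.inr ⟨a, hST ha, h⟩
  obtain ⟨φ, hφ⟩ := exists_dual_of_directed k E hE (by
    intro S
    obtain ⟨s, hs, hc⟩ := h S
    have hφ : ∀ a x η, DirectSum.toModule k A k (fun a => TensorProduct.lift
        ((Module.Dual.eval k (G.obj a)) ∘ₗ (s a).hom)) (δ a x η) = η ((s a).hom x) := by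
      intro a x η
      simp only [δ]
      erw [DirectSum.toModule_lof]
      simp
    refine ⟨DirectSum.toModule k A k (fun a => TensorProduct.lift
      ((Module.Dual.eval k (G.obj a)) ∘ₗ (s a).hom)), ?_⟩
    rintro e (⟨a, ha, b, hb, α, x, η, rfl⟩ | ⟨a, ha, x, η, c, h, rfl⟩)
    · have := congr(($(hs a ha b hb α)).hom x)
      simp only [ModuleCat.hom_comp, LinearMap.comp_apply] at this
      rw [map_sub, hφ, hφ, this]
      simp
    · rw [hφ]
      exact hc a ha x η c h)
  let t : ∀ a, F.obj a →ₗ[k] G.obj a := fun a =>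
    (Module.evalEquiv k (G.obj a)).symm.toLinearMap ∘ₗ
      (TensorProduct.mk k (F.obj a) (Module.Dual k (G.obj a))).compr₂
        (φ ∘ₗ DirectSum.lof k A W a)
  have ht : ∀ a x η, η (t a x) = φ (δ a x η) := by
    intro a x η
    simp [t, δ]
  refine ⟨⟨fun a => ModuleCat.ofHom (t a), ?_⟩, ?_⟩
  · intro a b α
    ext x
    refine Module.forall_dual_apply_eq_zero_iff k _ |>.1 ?_ |> sub_eq_zero.1
    intro η
    have h1 := hφ {a, b} _ (Or.inl ⟨a, by simp, b, by simp, α, x, η, rfl⟩)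
    rw [map_sub, ← ht, ← ht] at h1
    simpa using h1
  · intro a x η c h
    have h1 := hφ {a} _ (Or.inr ⟨a, by simp, x, η, c, h, rfl⟩)
    rw [← ht] at h1
    exact h1

theorem exists_section_of_finite {M N : A ⥤ ModuleCat.{0} k}
    (hM : ∀ a, FiniteDimensional k (M.obj a)) (g : M ⟶ N)
    (h : ∀ S : Finset A, ∃ (X : A ⥤ ModuleCat.{0} k) (u : X ⟶ N) (v : X ⟶ M),
      v ≫ g = u ∧ ∀ a ∈ S, IsIso (u.app a)) : IsSplitEpi g := by
  obtain ⟨t, ht⟩ := exists_natTrans_of_finite k hM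
    (fun a x η c => ∃ ξ : Module.Dual k (N.obj a), η = ξ ∘ₗ (g.app a).hom ∧ c = ξ x) (by
      intro S
      obtain ⟨X, u, v, hv, hu⟩ := h S
      have : ∀ a, ∃ w : N.obj a ⟶ X.obj a, a ∈ S → w ≫ u.app a = 𝟙 _ ∧ u.app a ≫ w = 𝟙 _ := by
        intro a
        by_cases ha : a ∈ S
        · have := hu a ha
          exact ⟨inv (u.app a), fun _ => by simp⟩
        · exact ⟨0, fun h => (ha h).elim⟩
      choose w hw using this
      refine ⟨fun a => w a ≫ v.app a, ?_, ?_⟩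
      · intro a ha b hb α
        have := hu a ha
        rw [← cancel_epi (u.app a), ← NatTrans.naturality_assoc, reassoc_of% (hw b hb).2,
          Category.assoc, reassoc_of% (hw a ha).2, NatTrans.naturality]
      · rintro a ha x _ _ ⟨ξ, rfl, rfl⟩
        have h1 : (w a ≫ v.app a) ≫ g.app a = 𝟙 _ := by
          rw [Category.assoc, ← NatTrans.comp_app, hv, (hw a ha).1]
        exact congr(ξ (($h1).hom x)))
  refine ⟨⟨⟨t, ?_⟩⟩⟩
  ext a x
  refine Module.forall_dual_apply_eq_zero_iff k _ |>.1 ?_ |> sub_eq_zero.1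
  intro ξ
  have := ht a x _ _ ⟨ξ, rfl, rfl⟩
  rw [map_sub, sub_eq_zero]
  exact this

theorem exists_retraction_of_finite {L M : A ⥤ ModuleCat.{0} k}
    (hL : ∀ a, FiniteDimensional k (L.obj a)) (f : L ⟶ M)
    (h : ∀ S : Finset A, ∃ (X : A ⥤ ModuleCat.{0} k) (u : L ⟶ X) (v : M ⟶ X),
      f ≫ v = u ∧ ∀ a ∈ S, IsIso (u.app a)) : IsSplitMono f := by
  obtain ⟨t, ht⟩ := exists_natTrans_of_finite k hL
    (fun a x η c => ∃ l : L.obj a, x = (f.app a).hom l ∧ c = η l) (by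
      intro S
      obtain ⟨X, u, v, hv, hu⟩ := h S
      have : ∀ a, ∃ w : X.obj a ⟶ L.obj a, a ∈ S → w ≫ u.app a = 𝟙 _ ∧ u.app a ≫ w = 𝟙 _ := by
        intro a
        by_cases ha : a ∈ S
        · have := hu a ha
          exact ⟨inv (u.app a), fun _ => by simp⟩
        · exact ⟨0, fun h => (ha h).elim⟩
      choose w hw using this
      refine ⟨fun a => v.app a ≫ w a, ?_, ?_⟩
      · intro a ha b hb α
        have := hu b hb
        rw [← cancel_mono (u.app b)]
        simp only [Category.assoc, (hw b hb).1, NatTrans.naturality, reassoc_of% (hw a ha).1,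
          Category.comp_id]
      · rintro a ha _ ξ _ ⟨l, rfl, rfl⟩
        have h1 : f.app a ≫ v.app a ≫ w a = 𝟙 _ := by
          rw [← Category.assoc, ← NatTrans.comp_app, hv, (hw a ha).2]
        exact congr(ξ (($h1).hom l)))
  refine ⟨⟨⟨t, ?_⟩⟩⟩
  ext a x
  refine Module.forall_dual_apply_eq_zero_iff k _ |>.1 ?_ |> sub_eq_zero.1
  intro ξ
  have := ht a _ ξ _ ⟨x, rfl, rfl⟩
  rw [map_sub, sub_eq_zero]
  exact this

theorem app_surjective_of_epi {F G : A ⥤ ModuleCat.{0} k} (p : F ⟶ G) [Epi p] (a : A) :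
    Function.Surjective (p.app a).hom :=
  (ModuleCat.epi_iff_surjective _).1 inferInstance

theorem app_injective_of_mono {F G : A ⥤ ModuleCat.{0} k} (i : F ⟶ G) [Mono i] (a : A) :
    Function.Injective (i.app a).hom :=
  (ModuleCat.mono_iff_injective _).1 inferInstance

theorem epi_of_app_surjective {F G : A ⥤ ModuleCat.{0} k} (p : F ⟶ G)
    (h : ∀ a, Function.Surjective (p.app a).hom) : Epi p :=
  have : ∀ a, Epi (p.app a) := fun a => (ModuleCat.epi_iff_surjective _).2 (h a)
  NatTrans.epi_of_epi_app p

theorem mono_of_app_injective {F G : A ⥤ ModuleCat.{0} k} (p : F ⟶ G)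
    (h : ∀ a, Function.Injective (p.app a).hom) : Mono p :=
  have : ∀ a, Mono (p.app a) := fun a => (ModuleCat.mono_iff_injective _).2 (h a)
  NatTrans.mono_of_mono_app p

theorem isIso_app_of_bijective {F G : A ⥤ ModuleCat.{0} k} (p : F ⟶ G) (a : A)
    (h : Function.Bijective (p.app a).hom) : IsIso (p.app a) :=
  (ConcreteCategory.isIso_iff_bijective _).2 h

theorem exists_app_eq_of_exact {X Y Z : A ⥤ ModuleCat.{0} k} {f : X ⟶ Y} {g : Y ⟶ Z}
    {w : f ≫ g = 0} (h : (ShortComplex.mk f g w).Exact) (a : A) (y : Y.obj a)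
    (hy : (g.app a).hom y = 0) : ∃ x : X.obj a, (f.app a).hom x = y :=
  (ShortComplex.moduleCat_exact_iff _).1 (h.map ((evaluation A (ModuleCat k)).obj a)) y hy

theorem exists_kernel_ι_app_eq {X Y : A ⥤ ModuleCat.{0} k} (f : X ⟶ Y) (a : A) (x : X.obj a)
    (hx : (f.app a).hom x = 0) : ∃ z : (kernel f).obj a, ((kernel.ι f).app a).hom z = x :=
  exists_app_eq_of_exact k (ShortComplex.exact_kernel f) a x hx

theorem exists_app_eq_of_cokernel_π {X Y : A ⥤ ModuleCat.{0} k} (f : X ⟶ Y) (a : A) (y : Y.obj a)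
    (hy : ((cokernel.π f).app a).hom y = 0) : ∃ x : X.obj a, (f.app a).hom x = y :=
  exists_app_eq_of_exact k (ShortComplex.exact_cokernel f) a y hy

theorem biproduct_app_ext {n : ℕ} (F : Fin n → (A ⥤ ModuleCat.{0} k)) (a : A)
    {x y : (⨁ F).obj a} (h : ∀ j, ((biproduct.π F j).app a).hom x =
      ((biproduct.π F j).app a).hom y) : x = y := by
  have h1 : ∀ z : (⨁ F).obj a, z = ∑ j, ((biproduct.ι F j).app a).hom
      (((biproduct.π F j).app a).hom z) := by
    intro z
    have := congr(($(biproduct.total (f := F)).app a).hom z)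
    rw [NatTrans.app_sum, ModuleCat.hom_sum, LinearMap.sum_apply] at this
    exact this.symm
  rw [h1 x, h1 y]
  simp [h]

variable [Preadditive A] [Linear k A]

variable {k} in
theorem IsLfdMod.of_mono {X Y : A ⥤ ModuleCat.{0} k} (hY : IsLfdMod k Y) (i : X ⟶ Y) [Mono i] :
    IsLfdMod k X := by
  refine ⟨⟨fun {a b} f g => ?_, fun {a b} r f => ?_⟩, fun a => ?_⟩
  · rw [← cancel_mono (i.app b)]
    simp [hY.1.1]
  · rw [← cancel_mono (i.app b)]
    simp [hY.1.2]
  · have := hY.2 a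
    exact FiniteDimensional.of_injective (i.app a).hom (app_injective_of_mono k i a)

variable {k} in
theorem IsLfdMod.of_epi {X Y : A ⥤ ModuleCat.{0} k} (hX : IsLfdMod k X) (p : X ⟶ Y) [Epi p] :
    IsLfdMod k Y := by
  refine ⟨⟨fun {a b} f g => ?_, fun {a b} r f => ?_⟩, fun a => ?_⟩
  · rw [← cancel_epi (p.app a)]
    simp only [← NatTrans.naturality, hX.1.1, Preadditive.add_comp, Preadditive.comp_add]
  · rw [← cancel_epi (p.app a)]
    simp only [← NatTrans.naturality, hX.1.2, Linear.smul_comp, Linear.comp_smul]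
  · have := hX.2 a
    exact Module.Finite.of_surjective (p.app a).hom (app_surjective_of_epi k p a)

theorem isLfdMod_biproduct {n : ℕ} (F : Fin n → (A ⥤ ModuleCat.{0} k))
    (hF : ∀ j, IsLfdMod k (F j)) : IsLfdMod k (⨁ F) := by
  have hnat : ∀ {a b : A} (f : a ⟶ b) j (x : (⨁ F).obj a),
      ((biproduct.π F j).app b).hom (((⨁ F).map f).hom x) =
        ((F j).map f).hom (((biproduct.π F j).app a).hom x) := fun f j x =>
    congr(($((biproduct.π F j).naturality f)).hom x)
  refine ⟨⟨fun {a b} f g => ?_, fun {a b} r f => ?_⟩, fun a => ?_⟩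
  · ext x
    refine biproduct_app_ext k F b fun j => ?_
    simp [hnat, (hF j).1.1]
  · ext x
    refine biproduct_app_ext k F b fun j => ?_
    simp [hnat, (hF j).1.2]
  · have := fun j => (hF j).2 a
    exact FiniteDimensional.of_injective
      (LinearMap.pi fun j => ((biproduct.π F j).app a).hom)
      (fun x y h => biproduct_app_ext k F a fun j => congrFun h j)

theorem isLfdMod_projAt [Spectroid k A] (a : A) : IsLfdMod k (ProjAt k a) := by
  refine ⟨⟨fun {b c} f g => ?_, fun {b c} r f => ?_⟩, fun b =>
    Spectroid.homFinite (k := k) a b⟩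
  · ext x
    exact Preadditive.comp_add _ _ _ _ _ _
  · ext x
    exact Linear.comp_smul _ _ _ _ _ _

theorem isLfdMod_injAt [Spectroid k A] (a : A) : IsLfdMod k (InjAt k a) := by
  refine ⟨⟨fun {b c} f g => ?_, fun {b c} r f => ?_⟩, fun b => ?_⟩
  · ext (x : Module.Dual k (b ⟶ a))
    refine LinearMap.ext fun (y : c ⟶ a) => ?_
    change x ((f + g) ≫ y) = x (f ≫ y) + x (g ≫ y)
    rw [Preadditive.add_comp, map_add]
  · ext (x : Module.Dual k (b ⟶ a))
    refine LinearMap.ext fun (y : c ⟶ a) => ?_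
    change x ((r • f) ≫ y) = r • x (f ≫ y)
    rw [Linear.smul_comp, map_smul]
  · have := Spectroid.homFinite (k := k) b a
    exact inferInstanceAs (FiniteDimensional k (Module.Dual k (b ⟶ a)))

/-- The morphism `P_a ⟶ M` given by an element of `M a`. -/
noncomputable def ofElement {M : A ⥤ ModuleCat.{0} k} (hM : IsMod k M) {a : A} (x : M.obj a) :
    ProjAt k a ⟶ M where
  app b := ModuleCat.ofHom (X := (a ⟶ b))
    { toFun := fun f => (M.map f).hom x
      map_add' := fun f g => by rw [hM.1]; rfl
      map_smul' := fun r f => by rw [hM.2]; rfl }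
  naturality b c f := by
    ext (y : a ⟶ b)
    exact congr(($(M.map_comp y f)).hom x)

/-- The morphism `M ⟶ I_a` given by a linear form on `M a`. -/
noncomputable def ofForm {M : A ⥤ ModuleCat.{0} k} (hM : IsMod k M) {a : A}
    (ξ : Module.Dual k (M.obj a)) : M ⟶ InjAt k a where
  app b := ModuleCat.ofHom (Y := Module.Dual k (b ⟶ a))
    { toFun := fun x =>
        { toFun := fun f => ξ ((M.map f).hom x)
          map_add' := fun f g => by rw [hM.1]; exact map_add ξ _ _
          map_smul' := fun r f => by rw [hM.2]; exact map_smul ξ _ _ }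
      map_add' := fun x y => by
        refine LinearMap.ext fun f => ?_
        change ξ ((M.map f).hom (x + y)) = ξ ((M.map f).hom x) + ξ ((M.map f).hom y)
        rw [map_add, map_add]
      map_smul' := fun r x => by
        refine LinearMap.ext fun f => ?_
        change ξ ((M.map f).hom (r • x)) = r • ξ ((M.map f).hom x)
        rw [map_smul, map_smul] }
  naturality b c f := by
    ext x
    refine LinearMap.ext fun (y : c ⟶ a) => ?_
    exact congr(ξ (($(M.map_comp f y)).hom x)).symm

theorem ofElement_app_id {M : A ⥤ ModuleCat.{0} k} (hM : IsMod k M) {a : A} (x : M.obj a) :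
    ((ofElement k hM x).app a).hom (𝟙 a : a ⟶ a) = x :=
  congr(($(M.map_id a)).hom x)

theorem ofForm_app_id {M : A ⥤ ModuleCat.{0} k} (hM : IsMod k M) {a : A}
    (ξ : Module.Dual k (M.obj a)) (x : M.obj a) :
    (show Module.Dual k (a ⟶ a) from ((ofForm k hM ξ).app a).hom x) (𝟙 a) = ξ x :=
  congr(ξ (($(M.map_id a)).hom x))

variable {k} in
theorem projAt_hom_ext {X : A ⥤ ModuleCat.{0} k} {a : A} {h h' : ProjAt k a ⟶ X}
    (e : h.app a = h'.app a) : h = h' := by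
  ext b (f : a ⟶ b)
  have key : ∀ t : ProjAt k a ⟶ X, (t.app b).hom f =
      (X.map f).hom ((t.app a).hom (𝟙 a : a ⟶ a)) := fun t => by
    have := congr(($(t.naturality f)).hom (𝟙 a : a ⟶ a))
    refine Eq.trans ?_ this
    exact congrArg (t.app b).hom (Category.id_comp f).symm
  rw [key h, key h', e]

variable {k} in
theorem injAt_hom_ext {X : A ⥤ ModuleCat.{0} k} {a : A} {h h' : X ⟶ InjAt k a}
    (e : h.app a = h'.app a) : h = h' := by
  ext b x
  refine LinearMap.ext fun (f : b ⟶ a) => ?_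
  have key : ∀ t : X ⟶ InjAt k a, (show Module.Dual k (b ⟶ a) from (t.app b).hom x) f =
      (show Module.Dual k (a ⟶ a) from (t.app a).hom ((X.map f).hom x)) (𝟙 a) := fun t => by
    have := congr((show Module.Dual k (a ⟶ a) from ($(t.naturality f)).hom x) (𝟙 a))
    refine Eq.trans ?_ this.symm
    exact congrArg (show Module.Dual k (b ⟶ a) from (t.app b).hom x) (Category.comp_id f).symm
  refine (key h).trans (Eq.trans ?_ (key h').symm)
  rw [e]

/-- A module with finite dimensional values is covered, on a finite set of objects, by a finite
sum of projectives at these objects. -/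
theorem exists_projAt_surjective_on {N : A ⥤ ModuleCat.{0} k} (hN : IsLfdMod k N) (S : Finset A) :
    ∃ (r : ℕ) (a : Fin r → A) (p : (⨁ fun i => ProjAt k (a i)) ⟶ N),
      (∀ i, a i ∈ S) ∧ ∀ b ∈ S, Function.Surjective (p.app b).hom := by
  have := hN.2
  let ι := Σ s : S, Fin (Module.finrank k (N.obj s))
  obtain ⟨r, ⟨e⟩⟩ := Finite.exists_equiv_fin ι
  refine ⟨r, fun i => (e.symm i).1, biproduct.desc fun i =>
    ofElement k hN.1 (Module.finBasis k (N.obj (e.symm i).1) (e.symm i).2),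
    fun i => (e.symm i).1.2, fun b hb => ?_⟩
  rw [← LinearMap.range_eq_top, ← top_le_iff, ← (Module.finBasis k (N.obj b)).span_eq,
    Submodule.span_le]
  rintro _ ⟨j, rfl⟩
  obtain ⟨i, hi⟩ := e.symm.surjective ⟨⟨b, hb⟩, j⟩
  have key : ∀ x : ι, x = e.symm i →
      (Module.finBasis k (N.obj x.1)) x.2 ∈ LinearMap.range
        (((biproduct.desc fun i => ofElement k hN.1
          (Module.finBasis k (N.obj (e.symm i).1) (e.symm i).2)).app x.1).hom) := by
    rintro _ rfl
    have h1 := biproduct.ι_desc (fun i => ofElement k hN.1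
      (Module.finBasis k (N.obj (e.symm i).1) (e.symm i).2)) i
    have h2 := congr((($h1).app (e.symm i).1).hom
      (𝟙 _ : ((e.symm i).1 : A) ⟶ (e.symm i).1))
    rw [ofElement_app_id] at h2
    exact ⟨_, h2⟩
  exact key _ hi.symm

/-- A module with finite dimensional values embeds, on a finite set of objects, into a finite
sum of injectives at these objects. -/
theorem exists_injAt_injective_on {L : A ⥤ ModuleCat.{0} k} (hL : IsLfdMod k L) (S : Finset A) :
    ∃ (r : ℕ) (a : Fin r → A) (q : L ⟶ ⨁ fun i => InjAt k (a i)),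
      (∀ i, a i ∈ S) ∧ ∀ b ∈ S, Function.Injective (q.app b).hom := by
  have := hL.2
  let ι := Σ s : S, Fin (Module.finrank k (L.obj s))
  obtain ⟨r, ⟨e⟩⟩ := Finite.exists_equiv_fin ι
  refine ⟨r, fun i => (e.symm i).1, biproduct.lift fun i =>
    ofForm k hL.1 ((Module.finBasis k (L.obj (e.symm i).1)).coord (e.symm i).2),
    fun i => (e.symm i).1.2, fun b hb => ?_⟩
  rw [injective_iff_map_eq_zero]
  intro x hx
  refine (Module.finBasis k (L.obj b)).forall_coord_eq_zero_iff.1 fun j => ?_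
  obtain ⟨i, hi⟩ := e.symm.surjective ⟨⟨b, hb⟩, j⟩
  have key : ∀ (y : ι) (x : L.obj y.1), y = e.symm i →
      ((biproduct.lift fun i => ofForm k hL.1
        ((Module.finBasis k (L.obj (e.symm i).1)).coord (e.symm i).2)).app y.1).hom x = 0 →
      (Module.finBasis k (L.obj y.1)).coord y.2 x = 0 := by
    rintro _ x rfl hx
    have h1 := biproduct.lift_π (fun i => ofForm k hL.1
        ((Module.finBasis k (L.obj (e.symm i).1)).coord (e.symm i).2)) i
    have h2 := congr((show Module.Dual k (((e.symm i).1 : A) ⟶ (e.symm i).1) from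
      (($h1).app (e.symm i).1).hom x) (𝟙 _))
    rw [ofForm_app_id] at h2
    rw [← h2]
    simp only [NatTrans.comp_app, ModuleCat.hom_comp, LinearMap.comp_apply]
    erw [hx, map_zero]
    rfl
  exact key ⟨⟨b, hb⟩, j⟩ x hi.symm hx

theorem IsFP_of_right_almost_split [Spectroid k A] {M N : A ⥤ ModuleCat.{0} k}
    (hM : IsLfdMod k M) (hN : IsLfdMod k N) (g : M ⟶ N) (hg : ¬ IsSplitEpi g)
    (h : ∀ ⦃X : A ⥤ ModuleCat.{0} k⦄, IsLfdMod k X →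
      ∀ u : X ⟶ N, ¬ IsSplitEpi u → ∃ v : X ⟶ M, v ≫ g = u) : IsFP k N := by
  obtain ⟨S, hS⟩ : ∃ S : Finset A, ∀ (X : A ⥤ ModuleCat.{0} k) (u : X ⟶ N), IsLfdMod k X →
      (∀ a ∈ S, IsIso (u.app a)) → IsSplitEpi u := by
    by_contra! hc
    refine hg (exists_section_of_finite k hM.2 g fun S => ?_)
    obtain ⟨X, u, hX, hu, hn⟩ := hc S
    obtain ⟨v, hv⟩ := h hX u hn
    exact ⟨X, u, v, hv, hu⟩
  obtain ⟨r, a, p, ha, hp⟩ := exists_projAt_surjective_on k hN S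
  have hP := isLfdMod_biproduct k _ fun i => isLfdMod_projAt k (a i)
  obtain ⟨m, b, φ, -, hφ⟩ := exists_projAt_surjective_on k (hP.of_mono (kernel.ι p)) S
  let π := cokernel.π (φ ≫ kernel.ι p)
  let u : cokernel (φ ≫ kernel.ι p) ⟶ N := cokernel.desc _ p (by simp)
  have hπu : π ≫ u = p := cokernel.π_desc _ _ _
  have hw : (φ ≫ kernel.ι p) ≫ π = 0 := cokernel.condition _
  have hπu' : ∀ c x, (u.app c).hom ((π.app c).hom x) = (p.app c).hom x := fun c x =>
    congr((($hπu).app c).hom x)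
  have hu : ∀ c ∈ S, IsIso (u.app c) := by
    intro c hc
    refine isIso_app_of_bijective k u c ⟨?_, fun y => ?_⟩
    · rw [injective_iff_map_eq_zero]
      intro x hx
      obtain ⟨y, rfl⟩ := app_surjective_of_epi k π c x
      rw [hπu'] at hx
      obtain ⟨z, rfl⟩ := exists_kernel_ι_app_eq k p c y hx
      obtain ⟨w, rfl⟩ := hφ c hc z
      exact congr((($hw).app c).hom w)
    · obtain ⟨x, hx⟩ := hp c hc y
      exact ⟨_, (hπu' c x).trans hx⟩
  have hsplit := hS _ u (hP.of_epi π) hu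
  have hσ : u ≫ section_ u = 𝟙 _ := by
    rw [← cancel_epi π, Category.comp_id]
    refine biproduct.hom_ext' _ _ fun i => projAt_hom_ext ?_
    have := hu (a i) (ha i)
    rw [← cancel_mono (u.app (a i)), ← NatTrans.comp_app, ← NatTrans.comp_app]
    simp only [Category.assoc, IsSplitEpi.id, Category.comp_id]
  have hiso : IsIso u := ⟨section_ u, hσ, IsSplitEpi.id u⟩
  refine ⟨r, a, p, ?_, m, b, φ, epi_of_app_surjective k φ fun c z => ?_⟩
  · rw [← hπu]
    exact epi_comp _ _
  · obtain ⟨w, hw⟩ := exists_app_eq_of_cokernel_π k (φ ≫ kernel.ι p) c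
      (((kernel.ι p).app c).hom z) (by
        refine app_injective_of_mono k u c ?_
        rw [map_zero]
        refine (hπu' c _).trans ?_
        exact congr((($(kernel.condition p)).app c).hom z))
    exact ⟨w, app_injective_of_mono k (kernel.ι p) c hw⟩

theorem IsFCP_of_left_almost_split [Spectroid k A] {L M : A ⥤ ModuleCat.{0} k}
    (hL : IsLfdMod k L) (f : L ⟶ M) (hf : ¬ IsSplitMono f)
    (h : ∀ ⦃X : A ⥤ ModuleCat.{0} k⦄, IsLfdMod k X →
      ∀ u : L ⟶ X, ¬ IsSplitMono u → ∃ v : M ⟶ X, f ≫ v = u) : IsFCP k L := by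
  obtain ⟨S, hS⟩ : ∃ S : Finset A, ∀ (X : A ⥤ ModuleCat.{0} k) (u : L ⟶ X), IsLfdMod k X →
      (∀ a ∈ S, IsIso (u.app a)) → IsSplitMono u := by
    by_contra! hc
    refine hf (exists_retraction_of_finite k hL.2 f fun S => ?_)
    obtain ⟨X, u, hX, hu, hn⟩ := hc S
    obtain ⟨v, hv⟩ := h hX u hn
    exact ⟨X, u, v, hv, hu⟩
  obtain ⟨s, a, q, ha, hq⟩ := exists_injAt_injective_on k hL S
  have hI := isLfdMod_biproduct k _ fun i => isLfdMod_injAt k (a i)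
  obtain ⟨m, b, ψ, -, hψ⟩ := exists_injAt_injective_on k (hI.of_epi (cokernel.π q)) S
  let ι := kernel.ι (cokernel.π q ≫ ψ)
  let u : L ⟶ kernel (cokernel.π q ≫ ψ) := kernel.lift _ q (by simp)
  have huι : u ≫ ι = q := kernel.lift_ι _ _ _
  have hw : ι ≫ cokernel.π q ≫ ψ = 0 := kernel.condition _
  have huι' : ∀ c x, (ι.app c).hom ((u.app c).hom x) = (q.app c).hom x := fun c x =>
    congr((($huι).app c).hom x)
  have hu : ∀ c ∈ S, IsIso (u.app c) := by
    intro c hc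
    refine isIso_app_of_bijective k u c ⟨fun x y hxy => ?_, fun x => ?_⟩
    · refine hq c hc ?_
      rw [← huι', ← huι', hxy]
    · have h0 : ((cokernel.π q).app c).hom ((ι.app c).hom x) = 0 := by
        refine hψ c hc ?_
        rw [map_zero]
        exact congr((($hw).app c).hom x)
      obtain ⟨l, hl⟩ := exists_app_eq_of_cokernel_π k q c _ h0
      exact ⟨l, app_injective_of_mono k ι c ((huι' c l).trans hl)⟩
  have hsplit := hS _ u (hI.of_mono ι) hu
  have hρ : retraction u ≫ u = 𝟙 _ := by
    rw [← cancel_mono ι, Category.id_comp]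
    refine biproduct.hom_ext _ _ fun i => injAt_hom_ext ?_
    have := hu (a i) (ha i)
    rw [← cancel_epi (u.app (a i)), ← NatTrans.comp_app, ← NatTrans.comp_app]
    simp only [Category.assoc, IsSplitMono.id_assoc]
  have hiso : IsIso u := ⟨retraction u, IsSplitMono.id u, hρ⟩
  refine ⟨s, a, q, ?_, m, b, ψ, mono_of_app_injective k ψ fun c => ?_⟩
  · rw [← huι]
    exact mono_comp _ _
  · rw [injective_iff_map_eq_zero]
    intro x hx
    obtain ⟨y, rfl⟩ := app_surjective_of_epi k (cokernel.π q) c x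
    obtain ⟨z, rfl⟩ := exists_kernel_ι_app_eq k (cokernel.π q ≫ ψ) c y hx
    obtain ⟨l, rfl⟩ := app_surjective_of_epi k u c z
    refine (congrArg ((cokernel.π q).app c).hom (huι' c l)).trans ?_
    exact congr((($(cokernel.condition q)).app c).hom l)

end AlmostSplit

variable (k : Type) [Field k] [IsAlgClosed k]
variable (A : Type) [Category.{0} A] [Preadditive A] [CategoryTheory.Linear k A]

/-- If `0 → L → M → N → 0` is an almost split sequence in `mod A`, then `L` is finitely
co-presented and `N` is finitely presented. -/
theorem statement_10 [Spectroid k A] {L M N : A ⥤ ModuleCat.{0} k}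
    (hL : IsLfdMod k L) (hM : IsLfdMod k M) (hN : IsLfdMod k N)
    (f : L ⟶ M) (g : M ⟶ N) (h : AlmostSplitSeq k f g) :
    IsFCP k L ∧ IsFP k N := by
  exact ⟨IsFCP_of_left_almost_split k hL f h.not_splitMono h.left_almost_split,
    IsFP_of_right_almost_split k hM hN g h.not_splitEpi h.right_almost_split⟩

end Paper
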